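/- Let t^B, t^C, α_W, α_N, β_W, β_N and the prices p_W^B, p_N^B, p_W^C, p_N^C be real numbers, set α⁺ = α_N + α_W, β⁺ = β_N + β_W, α⁻ = α_N − α_W, β⁻ = β_N − β_W, and assume 4·t^B·t^C − α⁺·β⁺ ≠ 0. If q_W^B, q_W^C satisfy the Nash-equilibrium indifference conditions U₀^B − p_W^B − t^B·q_W^B + α_W·q_W^C = U₀^B − p_N^B − t^B·(1 − q_W^B) + α_N·(1 − q_W^C) and U₀^C − p_W^C − t^C·q_W^C + β_W·q_W^B = U₀^C − p_N^C − t^C·(1 − q_W^C) + β_N·(1 − q_W^B), then q_W^B = 1/2 + (α⁺·(p_N^C − p_W^C) + 2·t^C·(p_N^B − p_W^B))/(4·t^B·t^C − α⁺·β⁺) − (t^C·α⁻ + α⁺·β⁻/2)/(4·t^B·t^C − α⁺·β⁺) and q_W^C = 1/2 + (β⁺·(p_N^B − p_W^B) + 2·t^B·(p_N^C − p_W^C))/(4·t^B·t^C − α⁺·β⁺) − (t^B·β⁻ + α⁻·β⁺/2)/(4·t^B·t^C − α⁺·β⁺). -/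

import Mathlib

/-- Duopoly Hotelling demands: the Nash indifference conditions determine the
WF participation rates of both groups. -/
theorem duopoly_demands
    (tB tC αW αN βW βN pWB pNB pWC pNC qWB qWC U0B U0C : ℝ)
    (αp αm βp βm : ℝ)
    (hαp : αp = αN + αW) (hβp : βp = βN + βW)
    (hαm : αm = αN - αW) (hβm : βm = βN - βW)
    (hden : 4 * tB * tC - αp * βp ≠ 0)
    (hB : U0B - pWB - tB * qWB + αW * qWC
        = U0B - pNB - tB * (1 - qWB) + αN * (1 - qWC))
    (hC : U0C - pWC - tC * qWC + βW * qWB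
        = U0C - pNC - tC * (1 - qWC) + βN * (1 - qWB)) :
    qWB = 1 / 2 + (αp * (pNC - pWC) + 2 * tC * (pNB - pWB)) / (4 * tB * tC - αp * βp)
          - (tC * αm + αp * βm / 2) / (4 * tB * tC - αp * βp) ∧
    qWC = 1 / 2 + (βp * (pNB - pWB) + 2 * tB * (pNC - pWC)) / (4 * tB * tC - αp * βp)
          - (tB * βm + αm * βp / 2) / (4 * tB * tC - αp * βp) := by
  constructor
  · have key : (qWB - 1 / 2) * (4 * tB * tC - αp * βp)
        = (αp * (pNC - pWC) + 2 * tC * (pNB - pWB)) - (tC * αm + αp * βm / 2) := by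
      subst hαp hβp hαm hβm
      linear_combination (-2 * tC) * hB - (αN + αW) * hC
    have h := eq_div_of_mul_eq hden key
    rw [sub_div] at h
    linarith
  · have key : (qWC - 1 / 2) * (4 * tB * tC - αp * βp)
        = (βp * (pNB - pWB) + 2 * tB * (pNC - pWC)) - (tB * βm + αm * βp / 2) := by
      subst hαp hβp hαm hβm
      linear_combination (-2 * tB) * hC - (βN + βW) * hB
    have h := eq_div_of_mul_eq hden key
    rw [sub_div] at h
    linarith
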